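/- arXiv:1408.0028 — 2 statements merged into one kernel-verified Lean document; each statement's English description precedes it below -/
import Mathlib

section
/- Let M : A → A be an exact monad on an abelian category A, and let N ⊆ A be a Serre subcategory with M(N) ⊆ N. Let M̄ be the induced monad on A/N. Then the functor Φ : M-Mod_A → M̄-Mod_{A/N} sending (X, λ) to (X, q(λ)) and θ to q(θ) induces an equivalence of categories Φ̄ : (M-Mod_A)/(M-Mod_N) → M̄-Mod_{A/N}. -/
open CategoryTheory CategoryTheory.Limits

universe v u v' u' v'' u''

/-- A predicate on the objects of an abelian category is a *Serre class* (determines a Serre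
subcategory) if it is closed under isomorphisms, contains the zero objects, and, for every
short exact sequence `0 ⟶ X₁ ⟶ X₂ ⟶ X₃ ⟶ 0`, the middle term satisfies it iff the two outer
terms do (closure under subobjects, quotient objects and extensions). -/
structure IsSerreClass {A : Type u} [Category.{v} A] [Abelian A] (N : A → Prop) : Prop where
  prop_of_iso : ∀ {X Y : A}, (X ≅ Y) → N X → N Y
  prop_of_isZero : ∀ X : A, IsZero X → N X
  prop_ses : ∀ S : ShortComplex A, S.ShortExact → (N S.X₂ ↔ N S.X₁ ∧ N S.X₃)

/-- The class of morphisms inverted by a functor. -/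
def invertedClass {A : Type u} [Category.{v} A] {B : Type u'} [Category.{v'} B]
    (F : A ⥤ B) : MorphismProperty A :=
  fun _ _ f => IsIso (F.map f)

/-- `q : A ⥤ D` realizes `D` as the Gabriel quotient `A/N` of the abelian category `A` by the
Serre subcategory `N`: it is exact, has essential kernel exactly `N`, and is a localization at
the class of morphisms it inverts (for an exact functor this class consists of the morphisms
whose kernel and cokernel lie in `N`). -/
structure IsQuotientBy {A : Type u} [Category.{v} A] {D : Type u'} [Category.{v'} D]
    (N : A → Prop) (q : A ⥤ D) : Prop where
  preservesFiniteLimits : PreservesFiniteLimits q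
  preservesFiniteColimits : PreservesFiniteColimits q
  essKernel : ∀ X : A, IsZero (q.obj X) ↔ N X
  isLocalization : q.IsLocalization (invertedClass q)

/-- An exact functor `F` between abelian categories is a *quotient functor* if the induced
functor from the Gabriel quotient of its source by its essential kernel is an equivalence;
equivalently, `F` realizes its target as the Gabriel quotient by its essential kernel. -/
def IsQuotientFunctor {A : Type u} [Category.{v} A] {B : Type u'} [Category.{v'} B]
    (F : A ⥤ B) : Prop :=
  IsQuotientBy (fun X => IsZero (F.obj X)) F

section helpers

variable {A : Type u} [Category.{v} A] [Abelian A]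
  {B : Type u'} [Category.{v'} B] [Abelian B]

lemma IsQuotientBy.serre {N : A → Prop} {q : A ⥤ B} (hq : IsQuotientBy N q) :
    ObjectProperty.IsSerreClass (N : ObjectProperty A) := by
  have := hq.preservesFiniteLimits
  have := hq.preservesFiniteColimits
  have h : (N : ObjectProperty A) = ObjectProperty.inverseImage (IsZero (C := B)) q := by
    ext X
    exact (hq.essKernel X).symm
  rw [h]
  infer_instance

lemma additive_of_finlim (q : A ⥤ B) [PreservesFiniteLimits q] : q.Additive :=
  q.additive_of_preserves_binary_products

lemma IsQuotientBy.isIso_iff {N : A → Prop} {q : A ⥤ B} (hq : IsQuotientBy N q)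
    {X Y : A} (f : X ⟶ Y) :
    IsIso (q.map f) ↔ N (kernel f) ∧ N (cokernel f) := by
  have := hq.preservesFiniteLimits
  have := hq.preservesFiniteColimits
  have := additive_of_finlim q
  rw [← hq.essKernel, ← hq.essKernel, isIso_iff_mono_and_epi]
  rw [(PreservesKernel.iso q f).isZero_iff, (PreservesCokernel.iso q f).isZero_iff]
  rw [Preadditive.mono_iff_isZero_kernel, Preadditive.epi_iff_isZero_cokernel]

lemma IsQuotientBy.isLoc {N : A → Prop} {q : A ⥤ B} (hq : IsQuotientBy N q) :
    letI := hq.serre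
    q.IsLocalization (ObjectProperty.isoModSerre (N : ObjectProperty A)) := by
  letI := hq.serre
  have h : ObjectProperty.isoModSerre (N : ObjectProperty A) = invertedClass q := by
    ext X Y f
    exact (hq.isIso_iff f).symm
  rw [h]
  exact hq.isLocalization

lemma faithful_of_exact (G : A ⥤ B) [PreservesFiniteLimits G] [PreservesFiniteColimits G]
    (h : ∀ X, IsZero (G.obj X) → IsZero X) : G.Faithful := by
  have := additive_of_finlim G
  refine ⟨fun {X Y f g} hfg => ?_⟩
  have h0 : G.map (f - g) = 0 := by rw [G.map_sub, hfg, sub_self]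
  have hz : IsZero (Abelian.image (f - g)) := by
    apply h
    rw [IsZero.iff_id_eq_zero]
    rw [← Abelian.image.fac (f - g), G.map_comp] at h0
    have h1 : G.map (Abelian.factorThruImage (f - g)) = 0 := by
      rw [← cancel_mono (G.map (Abelian.image.ι (f - g))), h0, zero_comp]
    rw [← cancel_epi (G.map (Abelian.factorThruImage (f - g))), h1, zero_comp, zero_comp]
  rw [← sub_eq_zero, ← Abelian.image.fac (f - g), hz.eq_zero_of_src (Abelian.image.ι (f - g)), comp_zero]

lemma IsQuotientBy.exact_of_comp {N : A → Prop} {q : A ⥤ B} (hq : IsQuotientBy N q)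
    {C : Type u''} [Category.{v''} C] [Abelian C] (G : B ⥤ C)
    [PreservesFiniteLimits (q ⋙ G)] [PreservesFiniteColimits (q ⋙ G)] :
    PreservesFiniteLimits G ∧ PreservesFiniteColimits G := by
  letI := hq.serre
  haveI := hq.isLoc
  have := hq.preservesFiniteLimits
  have := additive_of_finlim q
  exact ⟨(ObjectProperty.SerreClassLocalization.preservesFiniteLimits_comp_iff q N G).1
    inferInstance,
    (ObjectProperty.SerreClassLocalization.preservesFiniteColimits_comp_iff q N G).1
    inferInstance⟩

lemma IsQuotientBy.essSurj {N : A → Prop} {q : A ⥤ B} (hq : IsQuotientBy N q) :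
    q.EssSurj :=
  have := hq.isLocalization
  Localization.essSurj q (invertedClass q)

lemma IsQuotientBy.exists_roof {N : A → Prop} {q : A ⥤ B} (hq : IsQuotientBy N q)
    {X Y : A} (φ : q.obj X ⟶ q.obj Y) :
    ∃ (Z : A) (s : Z ⟶ X) (f : Z ⟶ Y), IsIso (q.map s) ∧ q.map s ≫ φ = q.map f := by
  letI := hq.serre
  haveI := hq.isLoc
  obtain ⟨r, hr⟩ := Localization.exists_rightFraction q
    (ObjectProperty.isoModSerre (N : ObjectProperty A)) φ
  refine ⟨r.X', r.s, r.f, Localization.inverts q _ _ r.hs, ?_⟩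
  rw [hr, MorphismProperty.RightFraction.map_s_comp_map]

end helpers

section main

variable {A : Type u} [Category.{v} A] [Abelian A] {M : Monad A}
    {D : Type u} [Category.{v} D] [Abelian D]
    {q : A ⥤ D} {Mb : Monad D} (e : q ⋙ (Mb : D ⥤ D) ≅ (M : A ⥤ A) ⋙ q)
    {E : Type u} [Category.{v} E]
    {qAlg : Monad.Algebra M ⥤ E} {Φ : E ⥤ Monad.Algebra Mb}
    (i : qAlg ⋙ Φ ⋙ Mb.forget ≅ M.forget ⋙ q)
    (hi : ∀ P : Monad.Algebra M, (Φ.obj (qAlg.obj P)).a =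
            Mb.map (i.hom.app P) ≫ e.hom.app P.A ≫ q.map P.a ≫ i.inv.app P)

include hi in
lemma exists_free_iso
    (hmul : ∀ X : A, Mb.μ.app (q.obj X) ≫ e.hom.app X =
      Mb.map (e.hom.app X) ≫ e.hom.app (M.obj X) ≫ q.map (M.μ.app X))
    [q.EssSurj] (Y : D) : ∃ Z : E, Nonempty (Φ.obj Z ≅ Mb.free.obj Y) := by
  refine ⟨qAlg.obj (M.free.obj (q.objPreimage Y)),
    ⟨?_ ≪≫ Mb.free.mapIso (q.objObjPreimageIso Y)⟩⟩
  generalize q.objPreimage Y = X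
  let I : (Φ.obj (qAlg.obj (M.free.obj X))).A ≅ q.obj (M.obj X) := i.app (M.free.obj X)
  let J : ∀ X : A, Mb.obj (q.obj X) ≅ q.obj (M.obj X) := fun X => e.app X
  have h1 : (Φ.obj (qAlg.obj (M.free.obj X))).a =
    Mb.map I.hom ≫ (J (M.obj X)).hom ≫ q.map (M.μ.app X) ≫ I.inv := hi (M.free.obj X)
  have h2 : Mb.μ.app (q.obj X) ≫ (J X).hom =
    Mb.map (J X).hom ≫ (J (M.obj X)).hom ≫ q.map (M.μ.app X) := hmul X
  clear_value I J
  have h3 : Mb.map (J X).inv ≫ Mb.μ.app (q.obj X) =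
      (J (M.obj X)).hom ≫ q.map (M.μ.app X) ≫ (J X).inv := by
    have h4 : Mb.μ.app (q.obj X) =
      Mb.map (J X).hom ≫ (J (M.obj X)).hom ≫ q.map (M.μ.app X) ≫ (J X).inv := by
      have := congrArg (fun t => t ≫ (J X).inv) h2
      simpa using this
    rw [h4, ← Functor.map_comp_assoc]
    simp
  have h5 : Mb.map (I.hom ≫ (J X).inv) ≫ Mb.μ.app (q.obj X) =
      (Φ.obj (qAlg.obj (M.free.obj X))).a ≫ I.hom ≫ (J X).inv := by
    rw [h1, Functor.map_comp, Category.assoc, h3]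
    simp
  exact Monad.Algebra.isoMk (I ≪≫ (J X).symm) h5

include hi in
lemma full_aux [Abelian E] (hq : ∀ {X Y : A} (φ : q.obj X ⟶ q.obj Y),
      ∃ (Z : A) (s : Z ⟶ X) (f : Z ⟶ Y), IsIso (q.map s) ∧ q.map s ≫ φ = q.map f)
    [qAlg.EssSurj] [(Φ ⋙ Mb.forget).Faithful] [(Φ ⋙ Mb.forget).Additive]
    [(Φ ⋙ Mb.forget).PreservesEpimorphisms] : Φ.Full := by
  suffices H : ∀ (P Q : Monad.Algebra M) (φ : Φ.obj (qAlg.obj P) ⟶ Φ.obj (qAlg.obj Q)),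
      ∃ ψ, Φ.map ψ = φ by
    refine ⟨fun {X Y} φ => ?_⟩
    obtain ⟨ψ, hψ⟩ := H _ _ (Φ.map (qAlg.objObjPreimageIso X).hom ≫ φ ≫
      Φ.map (qAlg.objObjPreimageIso Y).inv)
    refine ⟨(qAlg.objObjPreimageIso X).inv ≫ ψ ≫ (qAlg.objObjPreimageIso Y).hom, ?_⟩
    rw [Functor.map_comp, Functor.map_comp, hψ]
    simp only [Category.assoc, ← Functor.map_comp, ← Functor.map_comp_assoc]
    simp
  intro P Q φ
  let I : ∀ R : Monad.Algebra M, (Φ.obj (qAlg.obj R)).A ≅ q.obj R.A := fun R => i.app R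
  let J : ∀ X : A, Mb.obj (q.obj X) ≅ q.obj (M.obj X) := fun X => e.app X
  have hJ : ∀ {X Y : A} (g : X ⟶ Y), (J X).hom ≫ q.map (M.map g) =
      Mb.map (q.map g) ≫ (J Y).hom := fun g => (e.hom.naturality g).symm
  have hi' : ∀ R : Monad.Algebra M, (Φ.obj (qAlg.obj R)).a =
      Mb.map (I R).hom ≫ (J R.A).hom ≫ q.map R.a ≫ (I R).inv := hi
  have hnat : ∀ {R S : Monad.Algebra M} (g : R ⟶ S), (Φ.map (qAlg.map g)).f =
      (I R).hom ≫ q.map g.f ≫ (I S).inv := by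
    intro R S g
    have h2 : (Φ.map (qAlg.map g)).f ≫ (I S).hom = (I R).hom ≫ q.map g.f := i.hom.naturality g
    rw [← Category.assoc, Iso.eq_comp_inv]
    exact h2
  clear_value I J
  -- the underlying morphism
  obtain ⟨φ', hφ⟩ : ∃ φ' : q.obj P.A ⟶ q.obj Q.A, φ.f = (I P).hom ≫ φ' ≫ (I Q).inv :=
    ⟨(I P).inv ≫ φ.f ≫ (I Q).hom, by simp⟩
  have hφ' : (J P.A).hom ≫ q.map P.a ≫ φ' = Mb.map φ' ≫ (J Q.A).hom ≫ q.map Q.a := by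
    have h := φ.h
    rw [hi', hi', hφ] at h
    simp only [Functor.map_comp, Category.assoc, Iso.inv_hom_id_assoc] at h
    rw [← Functor.map_comp_assoc _ (I Q).inv] at h
    simp only [Iso.inv_hom_id, Functor.map_id, Category.id_comp] at h
    rw [cancel_epi (Mb.map (I P).hom)] at h
    simp only [← Category.assoc] at h
    rw [cancel_mono (I Q).inv] at h
    simpa using h.symm
  obtain ⟨Z, s, f, hs, hsf⟩ := hq φ'
  have hsf0 : q.map (M.map s ≫ P.a) ≫ φ' = q.map (M.map f ≫ Q.a) := by
    rw [← cancel_epi (J Z).hom]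
    calc (J Z).hom ≫ q.map (M.map s ≫ P.a) ≫ φ'
        = ((J Z).hom ≫ q.map (M.map s)) ≫ q.map P.a ≫ φ' := by
          simp only [Functor.map_comp, Category.assoc]
      _ = Mb.map (q.map s) ≫ (J P.A).hom ≫ q.map P.a ≫ φ' := by
          rw [hJ, Category.assoc]
      _ = Mb.map (q.map s ≫ φ') ≫ (J Q.A).hom ≫ q.map Q.a := by
          rw [hφ', Functor.map_comp, Category.assoc]
      _ = ((J Z).hom ≫ q.map (M.map f)) ≫ q.map Q.a := by
          rw [hsf, hJ, Category.assoc]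
      _ = (J Z).hom ≫ q.map (M.map f ≫ Q.a) := by
          simp only [Functor.map_comp, Category.assoc]
  have hη0 : M.η.app Z ≫ M.map s ≫ P.a = s := by
    have h1 : s ≫ M.η.app P.A = M.η.app Z ≫ M.map s := M.η.naturality s
    have h2 := P.unit
    rw [← Category.assoc, ← h1, Category.assoc, h2, Category.comp_id]
  obtain ⟨F, η, s', f', hsf', hη⟩ : ∃ (F : Monad.Algebra M) (η : Z ⟶ F.A) (s' : F ⟶ P)
      (f' : F ⟶ Q), q.map s'.f ≫ φ' = q.map f'.f ∧ η ≫ s'.f = s :=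
    ⟨M.free.obj Z, M.η.app Z, (M.adj.homEquiv Z P).symm s, (M.adj.homEquiv Z Q).symm f,
      by
        have h1 : ((M.adj.homEquiv Z P).symm s).f = M.map s ≫ P.a := by simp [Monad.adj]; rfl
        have h2 : ((M.adj.homEquiv Z Q).symm f).f = M.map f ≫ Q.a := by simp [Monad.adj]; rfl
        rw [h1, h2]
        exact hsf0,
      by
        have h1 : ((M.adj.homEquiv Z P).symm s).f = M.map s ≫ P.a := by simp [Monad.adj]; rfl
        rw [h1]
        exact hη0⟩
  have hepi : Epi (q.map s'.f) := by
    have h : q.map η ≫ q.map s'.f = q.map s := by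
      rw [← q.map_comp, hη]
    have : Epi (q.map η ≫ q.map s'.f) := by rw [h]; infer_instance
    exact epi_of_epi (q.map η) _
  have key : (Φ.map (qAlg.map s')).f ≫ φ.f = (Φ.map (qAlg.map f')).f := by
    rw [hnat, hnat, hφ, ← hsf']
    simp
  have hepi0 : Epi (Φ.map (qAlg.map s')).f := by
    rw [hnat]
    infer_instance
  have hepi' : Epi ((Φ ⋙ Mb.forget).map (qAlg.map s')) := hepi0
  replace key : (Φ ⋙ Mb.forget).map (qAlg.map s') ≫ Mb.forget.map φ =
    (Φ ⋙ Mb.forget).map (qAlg.map f') := key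
  have hepi2 : Epi (qAlg.map s') := (Φ ⋙ Mb.forget).epi_of_epi_map hepi'
  have hk : kernel.ι (qAlg.map s') ≫ qAlg.map f' = 0 := by
    apply (Φ ⋙ Mb.forget).map_injective
    rw [Functor.map_comp, ← key, ← Functor.map_comp_assoc, kernel.condition, Functor.map_zero,
      Functor.map_zero, zero_comp]
  refine ⟨Abelian.epiDesc (qAlg.map s') (qAlg.map f') hk, ?_⟩
  apply Mb.forget.map_injective
  change (Φ ⋙ Mb.forget).map _ = Mb.forget.map φ
  rw [← cancel_epi ((Φ ⋙ Mb.forget).map (qAlg.map s')), key, ← Functor.map_comp,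
    Abelian.comp_epiDesc]

lemma essSurj_aux [Abelian E] (Φ : E ⥤ Monad.Algebra Mb) [Φ.Full]
    [(Φ ⋙ Mb.forget).Faithful] [PreservesFiniteColimits (Φ ⋙ Mb.forget)]
    (H : ∀ Y : D, ∃ Z : E, Nonempty (Φ.obj Z ≅ Mb.free.obj Y)) : Φ.EssSurj := by
  refine ⟨fun Y => ?_⟩
  obtain ⟨E1, ⟨v⟩⟩ := H Y.A
  obtain ⟨E2, ⟨w⟩⟩ := H (Mb.obj Y.A)
  obtain ⟨f, hf⟩ := Φ.map_surjective (w.hom ≫ Monad.FreeCoequalizer.topMap Y ≫ v.inv)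
  obtain ⟨g, hg⟩ := Φ.map_surjective (w.hom ≫ Monad.FreeCoequalizer.bottomMap Y ≫ v.inv)
  let π := coequalizer.π f g
  have hcof : Monad.FreeCoequalizer.topMap Y ≫ v.inv ≫ Φ.map π =
      Monad.FreeCoequalizer.bottomMap Y ≫ v.inv ≫ Φ.map π := by
    rw [← cancel_epi w.hom]
    have := congrArg Φ.map (coequalizer.condition f g)
    rw [Functor.map_comp, Functor.map_comp, hf, hg] at this
    simpa using this
  obtain ⟨h, hh'⟩ : ∃ h : Y ⟶ Φ.obj (coequalizer f g),
      Monad.FreeCoequalizer.π Y ≫ h = v.inv ≫ Φ.map π :=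
    have t := Cofork.IsColimit.desc' (Monad.beckAlgebraCoequalizer Y) _ hcof
    ⟨t.1, t.2⟩
  let p : Φ.obj E1 ⟶ Y := v.hom ≫ Monad.FreeCoequalizer.π Y
  have hp : Φ.map f ≫ p = Φ.map g ≫ p := by
    simp [hf, hg, p, Monad.FreeCoequalizer.condition]
  have hcol := isColimitOfHasCoequalizerOfPreservesColimit (Φ ⋙ Mb.forget) f g
  obtain ⟨h', hh2'⟩ : ∃ h' : (Φ.obj (coequalizer f g)).A ⟶ Y.A, (Φ.map π).f ≫ h' = p.f :=
    have t := Cofork.IsColimit.desc' hcol p.f (congrArg Monad.Algebra.Hom.f hp)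
    ⟨t.1, t.2⟩
  have e1 : h.f ≫ h' = 𝟙 _ := by
    have : IsSplitEpi Y.a := ⟨⟨⟨Mb.η.app _, Y.unit⟩⟩⟩
    obtain ⟨v', h3, h4⟩ : ∃ v' : Mb.obj Y.A ⟶ (Φ.obj E1).A,
        Y.a ≫ h.f = v' ≫ (Φ.map π).f ∧ v' ≫ p.f = Y.a :=
      ⟨v.inv.f, congrArg Monad.Algebra.Hom.f hh', congrArg Monad.Algebra.Hom.f
        (show v.inv ≫ p = Monad.FreeCoequalizer.π Y by simp [p])⟩
    rw [← cancel_epi Y.a, reassoc_of% h3, hh2', h4, Category.comp_id]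
  have e2 : h' ≫ h.f = 𝟙 _ := by
    apply Cofork.IsColimit.hom_ext hcol
    change (Φ.map π).f ≫ h' ≫ h.f = (Φ.map π).f ≫ 𝟙 _
    rw [reassoc_of% hh2']
    have : p ≫ h = Φ.map π := by simp [p, hh']
    simpa using congrArg Monad.Algebra.Hom.f this
  have : IsIso (Mb.forget.map h) := ⟨h', e1, e2⟩
  have : IsIso h := isIso_of_reflects_iso h Mb.forget
  exact ⟨_, ⟨(asIso h).symm⟩⟩

end main

/-- **Modules over an exact monad are compatible with quotient abelian categories.**
Let `M` be an exact monad on an abelian category `A` and `N ⊆ A` a Serre subcategory with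
`M(N) ⊆ N`.  Let `q : A ⥤ A/N` be the quotient functor and `M̄` the induced monad on `A/N`
(so that `M̄ ∘ q ≅ q ∘ M` compatibly with units and multiplications).  Then the functor
`Φ : M-Mod_A ⥤ M̄-Mod_{A/N}`, `(X, λ) ↦ (q(X), q(λ))`, induces an equivalence
`Φ̄ : (M-Mod_A)/(M-Mod_N) ≃ M̄-Mod_{A/N}`; i.e. any functor from the quotient of `M-Mod_A`
by the modules with underlying object in `N` which is compatible with `Φ` is an equivalence. -/
theorem modules_over_exact_monad_and_quotients
    {A : Type u} [Category.{v} A] [Abelian A]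
    (M : Monad A) [PreservesFiniteLimits (M : A ⥤ A)] [PreservesFiniteColimits (M : A ⥤ A)]
    (N : A → Prop) (hN : IsSerreClass N) (hMN : ∀ X : A, N X → N (M.obj X))
    {D : Type u} [Category.{v} D] [Abelian D]
    (q : A ⥤ D) (hq : IsQuotientBy N q)
    -- the induced monad `M̄` on the quotient category `A/N`
    (Mb : Monad D) (e : q ⋙ (Mb : D ⥤ D) ≅ (M : A ⥤ A) ⋙ q)
    (hunit : ∀ X : A, Mb.η.app (q.obj X) ≫ e.hom.app X = q.map (M.η.app X))
    (hmul : ∀ X : A, Mb.μ.app (q.obj X) ≫ e.hom.app X =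
      Mb.map (e.hom.app X) ≫ e.hom.app (M.obj X) ≫ q.map (M.μ.app X))
    -- the quotient of the abelian category of `M`-modules by the modules lying in `N`
    [Abelian (Monad.Algebra M)] {E : Type u} [Category.{v} E] [Abelian E]
    (qAlg : Monad.Algebra M ⥤ E)
    (hqAlg : IsQuotientBy (fun P : Monad.Algebra M => N P.A) qAlg) :
    ∀ Φbar : E ⥤ Monad.Algebra Mb,
      (∃ i : qAlg ⋙ Φbar ⋙ Mb.forget ≅ M.forget ⋙ q,
        ∀ P : Monad.Algebra M,
          (Φbar.obj (qAlg.obj P)).a =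
            Mb.map (i.hom.app P) ≫ e.hom.app P.A ≫ q.map P.a ≫ i.inv.app P) →
      Φbar.IsEquivalence := by
  rintro Φ ⟨i, hi⟩
  have := hq.preservesFiniteLimits
  have := hq.preservesFiniteColimits
  have := hq.essSurj
  have := hqAlg.essSurj
  have : PreservesFiniteLimits M.forget := ⟨fun J _ _ => inferInstance⟩
  have : PreservesFiniteColimits M.forget := ⟨fun J _ _ => inferInstance⟩
  have : PreservesFiniteLimits (M.forget ⋙ q) := comp_preservesFiniteLimits _ _
  have : PreservesFiniteColimits (M.forget ⋙ q) := comp_preservesFiniteColimits _ _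
  have : PreservesFiniteLimits (qAlg ⋙ Φ ⋙ Mb.forget) := preservesFiniteLimits_of_natIso i.symm
  have : PreservesFiniteColimits (qAlg ⋙ Φ ⋙ Mb.forget) :=
    preservesFiniteColimits_of_natIso i.symm
  obtain ⟨_, _⟩ := hqAlg.exact_of_comp (Φ ⋙ Mb.forget)
  have : (Φ ⋙ Mb.forget).Additive := additive_of_finlim _
  have hz : ∀ X, IsZero ((Φ ⋙ Mb.forget).obj X) → IsZero X := by
    intro X hX
    refine IsZero.of_iso ?_ (qAlg.objObjPreimageIso X).symm
    rw [hqAlg.essKernel, ← hq.essKernel]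
    refine hX.of_iso ?_
    exact (i.app (qAlg.objPreimage X)).symm ≪≫
      (Φ ⋙ Mb.forget).mapIso (qAlg.objObjPreimageIso X)
  have : (Φ ⋙ Mb.forget).Faithful := faithful_of_exact _ hz
  have : Φ.Faithful := Functor.Faithful.of_comp Φ Mb.forget
  have : Φ.Full := full_aux e i hi (fun φ => hq.exists_roof φ)
  have : Φ.EssSurj := essSurj_aux Φ (exists_free_iso e i hi hmul)
  exact {}
end

section
/- Let p be a weight sequence of tubular type with p = lcm(p). Then for every integer n ≥ 1, the equation Σ_{j=0}^{p−1} mult(n x⃗_1 + j ω⃗) = n holds in the string group L(p). -/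
/-- The relations `p i • x⃗ᵢ = p 0 • x⃗₀` defining the string group `L(p)`. -/
def stringRel (t : ℕ) (p : Fin t → ℕ) : AddSubgroup (FreeAbelianGroup (Fin t)) :=
  AddSubgroup.closure
    { v | ∃ (i : Fin t) (h0 : 0 < t),
        v = (p i : ℤ) • FreeAbelianGroup.of i -
          (p ⟨0, h0⟩ : ℤ) • FreeAbelianGroup.of ⟨0, h0⟩ }

/-- The string group `L(p)` of a weight sequence `p`: the abelian group generated by
`x⃗₁, …, x⃗ₜ` subject to `p₁ x⃗₁ = ⋯ = p_t x⃗_t =: c⃗`. -/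
def StringGroup (t : ℕ) (p : Fin t → ℕ) : Type :=
  FreeAbelianGroup (Fin t) ⧸ stringRel t p

instance (t : ℕ) (p : Fin t → ℕ) : AddCommGroup (StringGroup t p) :=
  inferInstanceAs (AddCommGroup (FreeAbelianGroup (Fin t) ⧸ stringRel t p))

/-- The generator `x⃗ᵢ` of the string group. -/
def strGen (t : ℕ) (p : Fin t → ℕ) (i : Fin t) : StringGroup t p :=
  QuotientAddGroup.mk (FreeAbelianGroup.of i)

/-- The canonical element `c⃗ = pᵢ x⃗ᵢ` of the string group. -/
def strCan (t : ℕ) (p : Fin t → ℕ) (h0 : 0 < t) : StringGroup t p :=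
  (p ⟨0, h0⟩ : ℤ) • strGen t p ⟨0, h0⟩

/-- The dualizing element `ω⃗ = (t-2) c⃗ - ∑ᵢ x⃗ᵢ` of the string group. -/
def strDual (t : ℕ) (p : Fin t → ℕ) (h0 : 0 < t) : StringGroup t p :=
  ((t : ℤ) - 2) • strCan t p h0 - ∑ i : Fin t, strGen t p i

/-- Homomorphisms out of the string group. -/
noncomputable def strLift {A : Type} [AddCommGroup A] (t : ℕ) (p : Fin t → ℕ) (g : Fin t → A)
    (hg : ∀ i j, (p i : ℤ) • g i = (p j : ℤ) • g j) : StringGroup t p →+ A :=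
  QuotientAddGroup.lift (stringRel t p) (FreeAbelianGroup.lift g) (by
    rw [stringRel, AddSubgroup.closure_le]
    rintro v ⟨i, h0, rfl⟩
    simp only [SetLike.mem_coe, AddMonoidHom.mem_ker, map_sub, map_zsmul,
      FreeAbelianGroup.lift_apply_of]
    rw [hg i ⟨0, h0⟩, sub_self])

theorem strLift_gen {A : Type} [AddCommGroup A] (t : ℕ) (p : Fin t → ℕ) (g : Fin t → A)
    (hg : ∀ i j, (p i : ℤ) • g i = (p j : ℤ) • g j) (i : Fin t) :
    strLift t p g hg (strGen t p i) = g i :=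
  FreeAbelianGroup.lift_apply_of g i

theorem str_deg (t : ℕ) (p : Fin t → ℕ) (h0 : 0 < t) (hw : ∀ i, 2 ≤ p i) :
    ∃ d : StringGroup t p →+ ℚ, (∀ i, d (strGen t p i) = 1 / (p i : ℚ)) ∧
      d (strCan t p h0) = 1 := by
  have hp : ∀ i, (p i : ℚ) ≠ 0 := fun i => by have := hw i; positivity
  refine ⟨strLift t p (fun i => 1 / (p i : ℚ)) ?_, fun i => strLift_gen _ _ _ _ i, ?_⟩
  · intro i j
    simp [hp]
  · rw [strCan, map_zsmul, strLift_gen]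
    simp [hp]

theorem str_res (t : ℕ) (p : Fin t → ℕ) (h0 : 0 < t) (k : Fin t) :
    ∃ d : StringGroup t p →+ ZMod (p k),
      (∀ i, d (strGen t p i) = if i = k then 1 else 0) ∧ d (strCan t p h0) = 0 := by
  have hz : ∀ i, (p i : ℤ) • (if i = k then (1 : ZMod (p k)) else 0) = 0 := by
    intro i
    split_ifs with h
    · subst h; simp
    · simp
  refine ⟨strLift t p (fun i => if i = k then 1 else 0) ?_, fun i => strLift_gen _ _ _ _ i, ?_⟩
  · intro i j
    rw [hz, hz]
  · rw [strCan, map_zsmul, strLift_gen]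
    exact hz _

theorem str_phi (t : ℕ) (p : Fin t → ℕ) (h0 : 0 < t) (hw : ∀ i, 2 ≤ p i)
    (b : ℤ) (li : Fin t → ℕ) (hli : ∀ i, li i < p i) (a : ℤ) (f : Fin t → ℤ)
    (h : a • strCan t p h0 + ∑ i, f i • strGen t p i
      = b • strCan t p h0 + ∑ i : Fin t, (li i : ℤ) • strGen t p i) :
    b = a + ∑ i, f i / (p i : ℤ) := by
  have hr : ∀ k, (li k : ℤ) = f k % (p k : ℤ) := by
    intro k
    obtain ⟨d, hd, hc⟩ := str_res t p h0 k
    have := congrArg d h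
    simp only [map_add, map_sum, map_zsmul, hd, hc] at this
    simp only [smul_zero, zero_add, smul_ite, Finset.sum_ite_eq', Finset.mem_univ, if_true,
      zsmul_one] at this
    rw [ZMod.intCast_eq_intCast_iff] at this
    have h2 : f k % (p k : ℤ) = (li k : ℤ) % (p k : ℤ) := this
    rw [h2, Int.emod_eq_of_lt (by positivity) (by exact_mod_cast hli k)]
  obtain ⟨d, hd, hc⟩ := str_deg t p h0 hw
  have := congrArg d h
  simp only [map_add, map_sum, map_zsmul, hd, hc] at this
  have hf : ∀ i, f i • (1 / (p i : ℚ)) = ((f i / (p i : ℤ) : ℤ) : ℚ) + (li i : ℤ) • (1 / (p i : ℚ)) := by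
    intro i
    have hp : (p i : ℚ) ≠ 0 := by have := hw i; positivity
    have e : (f i : ℚ) = (p i : ℚ) * ((f i / (p i : ℤ) : ℤ) : ℚ) + ((li i : ℤ) : ℚ) := by
      rw [hr i]
      exact_mod_cast (Int.mul_ediv_add_emod (f i) (p i)).symm
    simp only [zsmul_eq_mul]
    rw [e]
    field_simp
  rw [Finset.sum_congr rfl (fun i _ => hf i), Finset.sum_add_distrib] at this
  simp only [zsmul_one] at this
  have h3 : (b : ℚ) = ((a + ∑ i, f i / (p i : ℤ) : ℤ) : ℚ) := by
    push_cast at this ⊢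
    linarith
  exact_mod_cast h3

theorem str_sum_deg (t : ℕ) (p : Fin t → ℕ) (h0 : 0 < t) (hw : ∀ i, 2 ≤ p i)
    (ht : IsOfFinAddOrder (strDual t p h0)) : ∑ i, 1 / (p i : ℚ) = (t : ℚ) - 2 := by
  obtain ⟨d, hd, hc⟩ := str_deg t p h0 hw
  obtain ⟨m, hm, h⟩ := isOfFinAddOrder_iff_nsmul_eq_zero.1 ht
  have := congrArg d h
  rw [map_nsmul, map_zero, strDual, map_sub, map_zsmul, map_sum, hc] at this
  simp only [hd] at this
  have h2 := (smul_eq_zero.1 this).resolve_left (by omega)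
  simp only [zsmul_one] at h2
  push_cast at h2
  linarith

theorem str_classify3 (a b c : ℕ) (hc : 2 ≤ c) (hcb : c ≤ b) (hba : b ≤ a)
    (h : 1 / (a : ℚ) + 1 / (b : ℚ) + 1 / (c : ℚ) = 1) :
    (a = 3 ∧ b = 3 ∧ c = 3) ∨ (a = 4 ∧ b = 4 ∧ c = 2) ∨ (a = 6 ∧ b = 3 ∧ c = 2) := by
  have ha' : (a : ℚ) ≠ 0 := by have : 0 < a := by omega
                               positivity
  have hb' : (b : ℚ) ≠ 0 := by have : 0 < b := by omega
                               positivity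
  have hc' : (c : ℚ) ≠ 0 := by positivity
  field_simp at h
  have h' : b * c + a * c + a * b = a * b * c := by
    have : (b * c + a * c + a * b : ℚ) = a * b * c := by linarith
    exact_mod_cast this
  have hc3 : c ≤ 3 := by
    by_contra hh
    have h1 : b * c ≤ b * a := Nat.mul_le_mul_left _ (by omega)
    have h2 : a * c ≤ a * b := Nat.mul_le_mul_left _ (by omega)
    have h3 : a * b * 4 ≤ a * b * c := Nat.mul_le_mul_left _ (by omega)
    have h4 : 0 < a * b := Nat.mul_pos (by omega) (by omega)
    nlinarith
  have hb4 : b ≤ 4 := by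
    by_contra hh
    interval_cases c <;> nlinarith
  interval_cases c <;> interval_cases b <;> omega

theorem str_term6 (q r j : ℕ) (hr : r < 6) (hj : j < 6) :
    ((6 * (q : ℤ) + r + 1 - j) / 6 + (j : ℤ) + (-(j : ℤ)) / 3 + (-(j : ℤ)) / 2 + 1).toNat
      = q + (((r : ℤ) + 1 - j) / 6 + (j : ℤ) + (-(j : ℤ)) / 3 + (-(j : ℤ)) / 2 + 1).toNat := by
  have e : (6 * (q : ℤ) + r + 1 - j) / 6 = q + ((r : ℤ) + 1 - j) / 6 := by omega
  have h : 0 ≤ ((r : ℤ) + 1 - j) / 6 + (j : ℤ) + (-(j : ℤ)) / 3 + (-(j : ℤ)) / 2 + 1 := by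
    clear e
    interval_cases j <;> omega
  rw [e]
  omega

/-- **The multiplicity sum formula for tubular weight sequences.**
Let `p` be a weight sequence of tubular type (the weights are `≥ 2`, listed in decreasing
order, and the dualizing element `ω⃗` is torsion), and let `P = lcm(p)`.  Writing each
element of `L(p)` in its normal form `x⃗ = φ(x⃗) c⃗ + ∑ᵢ lᵢ x⃗ᵢ` with `0 ≤ lᵢ < pᵢ`, and
setting `mult x⃗ = max (φ(x⃗) + 1) 0`, for every `n ≥ 1`:
`∑_{j=0}^{P-1} mult (n x⃗₁ + j ω⃗) = n`. -/
theorem tubular_multiplicity_sum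
    (t : ℕ) (p : Fin t → ℕ) (h0 : 0 < t)
    (hw : ∀ i, 2 ≤ p i) (hsorted : ∀ i j : Fin t, i ≤ j → p j ≤ p i)
    (htubular : IsOfFinAddOrder (strDual t p h0))
    (φ : StringGroup t p → ℤ)
    (hφ : ∀ x : StringGroup t p, ∃ li : Fin t → ℕ, (∀ i, li i < p i) ∧
      x = φ x • strCan t p h0 + ∑ i : Fin t, (li i : ℤ) • strGen t p i)
    (P : ℕ) (hP : P = Finset.univ.lcm p) :
    ∀ n : ℕ, 1 ≤ n →
      ∑ j ∈ Finset.range P,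
        (φ ((n : ℤ) • strGen t p ⟨0, h0⟩ + (j : ℤ) • strDual t p h0) + 1).toNat = n := by
  intro n hn
  have hdeg := str_sum_deg t p h0 hw htubular
  have key : ∀ j : ℕ, φ ((n : ℤ) • strGen t p ⟨0, h0⟩ + (j : ℤ) • strDual t p h0)
      = (j : ℤ) * ((t : ℤ) - 2) +
        ∑ i, ((if i = ⟨0, h0⟩ then (n : ℤ) else 0) - j) / (p i : ℤ) := by
    intro j
    obtain ⟨li, hli, h⟩ := hφ ((n : ℤ) • strGen t p ⟨0, h0⟩ + (j : ℤ) • strDual t p h0)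
    refine str_phi t p h0 hw _ li hli _ _ (Eq.trans ?_ h)
    simp only [sub_smul, Finset.sum_sub_distrib, ite_smul, zero_smul, Finset.sum_ite_eq',
      Finset.mem_univ, if_true, strDual, smul_sub, mul_smul, Finset.smul_sum]
    abel
  simp only [key]
  clear key hφ htubular φ
  have hhalf : ∀ i, 1 / (p i : ℚ) ≤ 1 / 2 := fun i => by
    have : (2 : ℚ) ≤ p i := by exact_mod_cast hw i
    exact one_div_le_one_div_of_le (by norm_num) this
  have hpos : ∀ i, 0 < 1 / (p i : ℚ) := fun i => by have := hw i; positivity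
  have ht4 : t ≤ 4 := by
    have : ∑ i, 1 / (p i : ℚ) ≤ ∑ i : Fin t, (1 / 2 : ℚ) := Finset.sum_le_sum fun i _ => hhalf i
    rw [hdeg] at this
    simp at this
    have : (t : ℚ) ≤ 4 := by linarith
    exact_mod_cast this
  have ht3 : 2 < t := by
    have : 0 < ∑ i, 1 / (p i : ℚ) := Finset.sum_pos (fun i _ => hpos i) ⟨⟨0, h0⟩, Finset.mem_univ _⟩
    rw [hdeg] at this
    have : (2 : ℚ) < t := by linarith
    exact_mod_cast this
  obtain rfl | rfl : t = 3 ∨ t = 4 := by omega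
  · rw [Fin.sum_univ_three] at hdeg
    have hcl := str_classify3 (p 0) (p 1) (p 2) (hw 2) (hsorted 1 2 (by decide))
      (hsorted 0 1 (by decide)) (by rw [hdeg]; norm_num)
    rcases hcl with ⟨e0, e1, e2⟩ | ⟨e0, e1, e2⟩ | ⟨e0, e1, e2⟩
    · have hp : p = ![3, 3, 3] := by
        funext i; fin_cases i <;> simp [e0, e1, e2]
      subst hp
      have hP' : P = 3 := by rw [hP]; rfl
      subst hP'
      simp [Finset.sum_range_succ, Fin.sum_univ_three]
      omega
    · have hp : p = ![4, 4, 2] := by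
        funext i; fin_cases i <;> simp [e0, e1, e2]
      subst hp
      have hP' : P = 4 := by rw [hP]; rfl
      subst hP'
      simp [Finset.sum_range_succ, Fin.sum_univ_three]
      omega
    · have hp : p = ![6, 3, 2] := by
        funext i; fin_cases i <;> simp [e0, e1, e2]
      subst hp
      have hP' : P = 6 := by rw [hP]; rfl
      subst hP'
      clear hdeg hhalf hpos hw hsorted e0 e1 e2 hP
      obtain ⟨q, r, hr, rfl⟩ : ∃ q r : ℕ, r < 6 ∧ n = 6 * q + r + 1 :=
        ⟨(n - 1) / 6, (n - 1) % 6, by omega, by omega⟩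
      refine (Finset.sum_congr rfl (g := fun j : ℕ => q + (((r : ℤ) + 1 - j) / 6 + (j : ℤ) + (-(j : ℤ)) / 3
        + (-(j : ℤ)) / 2 + 1).toNat) (fun j hj => ?_)).trans ?_
      · rw [← str_term6 q r j hr (Finset.mem_range.1 hj)]
        simp [Fin.sum_univ_three]
        congr 1
        ring_nf
      · rw [Finset.sum_add_distrib]
        have : ∑ j ∈ Finset.range 6, (((r : ℤ) + 1 - j) / 6 + (j : ℤ) + (-(j : ℤ)) / 3
            + (-(j : ℤ)) / 2 + 1).toNat = r + 1 := by
          clear hn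
          revert r
          decide
        rw [this]
        simp
        omega
  · rw [Fin.sum_univ_four] at hdeg
    norm_num at hdeg hhalf
    have h2 : ∀ i, p i = 2 := by
      have : ∀ i, (p i : ℚ)⁻¹ = 2⁻¹ := by
        have a0 := hhalf 0
        have a1 := hhalf 1
        have a2 := hhalf 2
        have a3 := hhalf 3
        have b0 : (p 0 : ℚ)⁻¹ = 2⁻¹ := by linarith
        have b1 : (p 1 : ℚ)⁻¹ = 2⁻¹ := by linarith
        have b2 : (p 2 : ℚ)⁻¹ = 2⁻¹ := by linarith
        have b3 : (p 3 : ℚ)⁻¹ = 2⁻¹ := by linarith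
        intro i
        fin_cases i <;> assumption
      intro i
      exact_mod_cast inv_injective (this i)
    have hp : p = ![2, 2, 2, 2] := by
      funext i; fin_cases i <;> simp [h2]
    subst hp
    have hP' : P = 2 := by rw [hP]; rfl
    subst hP'
    simp [Finset.sum_range_succ, Fin.sum_univ_four]
    omega
end
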